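/- For every event-clock automaton A: L(A) = wL(A), i.e., the weak language of A equals its language. In particular, every timed word accepted by a weak run (where after each delay step, prophecy clocks exceeding cmax may be nondeterministically reassigned any value exceeding cmax − t) is also accepted by a genuine run of A. -/

import Mathlib

/-- Event clocks over alphabet `α`: a history clock and a prophecy clock per letter. -/
inductive Clock (α : Type) where
  | hist (a : α)
  | proph (a : α)
deriving DecidableEq

/-- A valuation assigns to each event clock a real value or `⊥` (here `none`). -/
def Val (α : Type) := Clock α → Option ℝ

/-- All defined clock values are nonnegative. -/
def Nonneg {α : Type} (v : Val α) : Prop := ∀ x r, v x = some r → 0 ≤ r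

/-- `v[x := d]`. -/
def Val.set {α : Type} [DecidableEq α] (v : Val α) (x : Clock α) (d : Option ℝ) : Val α :=
  fun y => if y = x then d else v y

/-- Time elapse: history clocks increase, prophecy clocks decrease; `⊥` unaffected. -/
def elapse {α : Type} (v : Val α) (t : ℝ) : Val α := fun c =>
  match c with
  | .hist a => (v (.hist a)).map (· + t)
  | .proph a => (v (.proph a)).map (· - t)

/-- Time elapse by `t` is allowed: `t ≥ 0` and all prophecy clocks are at least `t`. -/
def CanElapse {α : Type} (v : Val α) (t : ℝ) : Prop :=
  0 ≤ t ∧ ∀ a r, v (.proph a) = some r → t ≤ r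

def InitialVal {α : Type} (v : Val α) : Prop := ∀ a, v (.hist a) = none

def FinalVal {α : Type} (v : Val α) : Prop := ∀ a, v (.proph a) = none

/-- Clock constraints: Boolean combinations of atomic constraints `x ∼ c`. -/
inductive Constr (α : Type) where
  | tt
  | lt (x : Clock α) (c : ℕ)
  | gt (x : Clock α) (c : ℕ)
  | eq (x : Clock α) (c : ℕ)
  | not (ψ : Constr α)
  | and (ψ₁ ψ₂ : Constr α)

def Constr.sat {α : Type} (v : Val α) : Constr α → Prop
  | .tt => True
  | .lt x c => ∃ r, v x = some r ∧ r < (c : ℝ)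
  | .gt x c => ∃ r, v x = some r ∧ (c : ℝ) < r
  | .eq x c => v x = some (c : ℝ)
  | .not ψ => ¬ Constr.sat v ψ
  | .and ψ₁ ψ₂ => Constr.sat v ψ₁ ∧ Constr.sat v ψ₂

/-- An event-clock automaton. -/
structure ECTA (α Q : Type) where
  init : Q
  edges : Set (Q × α × Constr α × Q)
  accept : Set Q

/-- Discrete step on letter `σ`: there is a nonnegative valuation `v̄` with
`v̄[→σ := 0] = v`, `v̄[←σ := 0] = v'` and `v̄ ⊨ ψ` for some edge `(q,σ,ψ,q')`. -/
def DStep {α Q : Type} [DecidableEq α] (A : ECTA α Q) (q : Q) (v : Val α) (σ : α)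
    (q' : Q) (v' : Val α) : Prop :=
  ∃ ψ, (q, σ, ψ, q') ∈ A.edges ∧
    ∃ vb : Val α, Nonneg vb ∧
      vb.set (.proph σ) (some 0) = v ∧
      vb.set (.hist σ) (some 0) = v' ∧
      Constr.sat vb ψ

/-- Combined step: elapse `t`, then fire a `σ`-edge. -/
def TStep {α Q : Type} [DecidableEq α] (A : ECTA α Q) (q : Q) (v : Val α) (t : ℝ) (σ : α)
    (q' : Q) (v' : Val α) : Prop :=
  CanElapse v t ∧ DStep A q (elapse v t) σ q' v'

/-- Acceptance of a timed word (given by successive delays) from state `(q,v)`. -/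
inductive ECAcc {α Q : Type} [DecidableEq α] (A : ECTA α Q) : Q → Val α → List (ℝ × α) → Prop where
  | nil : ∀ q v, q ∈ A.accept → FinalVal v → ECAcc A q v []
  | cons : ∀ q v t σ q' v' w, TStep A q v t σ q' v' → ECAcc A q' v' w → ECAcc A q v ((t, σ) :: w)

/-- `Untime(L(A,(q,v)))`. -/
def UntimedLangFrom {α Q : Type} [DecidableEq α] (A : ECTA α Q) (q : Q) (v : Val α) :
    Set (List α) :=
  { w | ∃ θ : List (ℝ × α), ECAcc A q v θ ∧ θ.map Prod.snd = w }

/-- The timed language of `A` (initialized runs). -/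
def TLang {α Q : Type} [DecidableEq α] (A : ECTA α Q) : Set (List (ℝ × α)) :=
  { θ | ∃ v, Nonneg v ∧ InitialVal v ∧ ECAcc A A.init v θ }

/-- `Untime(L(A))`. -/
def UntimedLang {α Q : Type} [DecidableEq α] (A : ECTA α Q) : Set (List α) :=
  { w | ∃ v, Nonneg v ∧ InitialVal v ∧ w ∈ UntimedLangFrom A A.init v }
/-- Distance to the relevant integer boundary: `⌈r⌉ − r` for history clocks,
`r − ⌊r⌋` for prophecy clocks. -/
noncomputable def fracDist {α : Type} : Clock α → ℝ → ℝ
  | .hist _, r => (⌈r⌉ : ℝ) - r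
  | .proph _, r => r - (⌊r⌋ : ℝ)

/-- Signed value used for diagonal constraints: prophecy clocks are negated. -/
def sval {α : Type} : Clock α → ℝ → ℝ
  | .hist _, r => r
  | .proph _, r => -r

/-- The Alur–Dill region equivalence with maximal constant `cmax`. -/
def RegEq {α : Type} (cmax : ℕ) (v₁ v₂ : Val α) : Prop :=
  (∀ x, v₁ x = none ↔ v₂ x = none) ∧
  (∀ x r₁ r₂, v₁ x = some r₁ → v₂ x = some r₂ →
      (((cmax : ℝ) < r₁ ∧ (cmax : ℝ) < r₂) ∨ (⌈r₁⌉ = ⌈r₂⌉ ∧ ⌊r₁⌋ = ⌊r₂⌋))) ∧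
  (∀ x y rx₁ ry₁ rx₂ ry₂, v₁ x = some rx₁ → v₁ y = some ry₁ →
      v₂ x = some rx₂ → v₂ y = some ry₂ → rx₁ ≤ (cmax : ℝ) → ry₁ ≤ (cmax : ℝ) →
      (fracDist x rx₁ ≤ fracDist y ry₁ ↔ fracDist x rx₂ ≤ fracDist y ry₂))

/-- The refined (Bouyer-style) region equivalence. -/
def RegEqD {α : Type} (cmax : ℕ) (v₁ v₂ : Val α) : Prop :=
  RegEq cmax v₁ v₂ ∧
  (∀ x y rx₁ ry₁ rx₂ ry₂, v₁ x = some rx₁ → v₁ y = some ry₁ →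
      v₂ x = some rx₂ → v₂ y = some ry₂ →
      ((cmax : ℝ) < rx₁ ∨ (cmax : ℝ) < ry₁) →
      ((2 * (cmax : ℝ) < |sval x rx₁ - sval y ry₁| ∧ 2 * (cmax : ℝ) < |sval x rx₂ - sval y ry₂|) ∨
       (⌊sval x rx₁ - sval y ry₁⌋ = ⌊sval x rx₂ - sval y ry₂⌋ ∧
        ⌈sval x rx₁ - sval y ry₁⌉ = ⌈sval x rx₂ - sval y ry₂⌉)))

/-- A region of an equivalence `E`: an equivalence class of nonnegative valuations. -/
def IsRegionOf {α : Type} (E : Val α → Val α → Prop) (r : Set (Val α)) : Prop :=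
  ∃ v, Nonneg v ∧ r = { v' | Nonneg v' ∧ E v v' }

def InitialRegion {α : Type} (r : Set (Val α)) : Prop := ∀ v ∈ r, InitialVal v
def FinalRegion {α : Type} (r : Set (Val α)) : Prop := ∀ v ∈ r, FinalVal v

/-- Acceptance in the universal region automaton `RA(∀,E,A)`. -/
inductive UAcc {α Q : Type} [DecidableEq α] (A : ECTA α Q) (E : Val α → Val α → Prop) :
    Q → Set (Val α) → List α → Prop where
  | nil : ∀ q r, q ∈ A.accept → IsRegionOf E r → FinalRegion r → UAcc A E q r []
  | cons : ∀ q r σ q' r' w, IsRegionOf E r → IsRegionOf E r' →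
      (∀ v ∈ r, ∃ t v', v' ∈ r' ∧ TStep A q v t σ q' v') →
      UAcc A E q' r' w → UAcc A E q r (σ :: w)

/-- Acceptance in the existential region automaton `RA(∃,E,A)`. -/
inductive EAcc {α Q : Type} [DecidableEq α] (A : ECTA α Q) (E : Val α → Val α → Prop) :
    Q → Set (Val α) → List α → Prop where
  | nil : ∀ q r, q ∈ A.accept → IsRegionOf E r → FinalRegion r → EAcc A E q r []
  | cons : ∀ q r σ q' r' w, IsRegionOf E r → IsRegionOf E r' →
      (∃ v ∈ r, ∃ t v', v' ∈ r' ∧ TStep A q v t σ q' v') →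
      EAcc A E q' r' w → EAcc A E q r (σ :: w)

/-- The language of the universal region automaton. -/
def ULang {α Q : Type} [DecidableEq α] (A : ECTA α Q) (E : Val α → Val α → Prop) :
    Set (List α) :=
  { w | ∃ r, IsRegionOf E r ∧ InitialRegion r ∧ UAcc A E A.init r w }

/-- The language of the existential region automaton. -/
def ELang {α Q : Type} [DecidableEq α] (A : ECTA α Q) (E : Val α → Val α → Prop) :
    Set (List α) :=
  { w | ∃ r, IsRegionOf E r ∧ InitialRegion r ∧ EAcc A E A.init r w }

/-- All constants in a constraint are at most `k`. -/
def Constr.BoundedBy {α : Type} (k : ℕ) : Constr α → Prop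
  | .tt => True
  | .lt _ c => c ≤ k
  | .gt _ c => c ≤ k
  | .eq _ c => c ≤ k
  | .not ψ => Constr.BoundedBy k ψ
  | .and ψ₁ ψ₂ => Constr.BoundedBy k ψ₁ ∧ Constr.BoundedBy k ψ₂

/-- `cmax` bounds all constants appearing in the guards of `A`. -/
def MaxConstLe {α Q : Type} (A : ECTA α Q) (k : ℕ) : Prop :=
  ∀ e ∈ A.edges, Constr.BoundedBy k e.2.2.1
/-- Weak time successors: prophecy clocks above `cmax` may be reassigned any
value above `cmax − t`; all other clocks behave as under exact time elapse. -/
def WeakSucc {α : Type} (cmax : ℕ) (v : Val α) (t : ℝ) (v' : Val α) : Prop :=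
  0 ≤ t ∧ Nonneg v' ∧
  (∀ a, v' (.hist a) = (v (.hist a)).map (· + t)) ∧
  (∀ a, v (.proph a) = none → v' (.proph a) = none) ∧
  (∀ a r, v (.proph a) = some r →
    (((cmax : ℝ) < r → ∃ r', v' (.proph a) = some r' ∧ (cmax : ℝ) - t < r') ∧
     (r ≤ (cmax : ℝ) → t ≤ r ∧ v' (.proph a) = some (r - t))))

/-- Acceptance along weak runs. -/
inductive WAcc {α Q : Type} [DecidableEq α] (A : ECTA α Q) (cmax : ℕ) :
    Q → Val α → List (ℝ × α) → Prop where
  | nil : ∀ q v, q ∈ A.accept → FinalVal v → WAcc A cmax q v []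
  | cons : ∀ q v t v'' σ q' v' w, WeakSucc cmax v t v'' → DStep A q v'' σ q' v' →
      WAcc A cmax q' v' w → WAcc A cmax q v ((t, σ) :: w)

/-- The weak timed language `wL(A)`. -/
def WLang {α Q : Type} [DecidableEq α] (A : ECTA α Q) (cmax : ℕ) : Set (List (ℝ × α)) :=
  { θ | ∃ v, Nonneg v ∧ InitialVal v ∧ WAcc A cmax A.init v θ }

/-- Valuations agreeing except that prophecy clocks above `cmax` may differ (both above). -/
def WSim {α : Type} (k : ℕ) (v u : Val α) : Prop :=
  (∀ a, u (.hist a) = v (.hist a)) ∧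
  (∀ a, u (.proph a) = v (.proph a) ∨
    ∃ r s, v (.proph a) = some r ∧ u (.proph a) = some s ∧ (k : ℝ) < r ∧ (k : ℝ) < s)

theorem WSim.clock {α : Type} {k : ℕ} {v u : Val α} (h : WSim k v u) (x : Clock α) :
    u x = v x ∨ ∃ r s, v x = some r ∧ u x = some s ∧ (k : ℝ) < r ∧ (k : ℝ) < s := by
  cases x with
  | hist a => exact Or.inl (h.1 a)
  | proph a => exact h.2 a

theorem WSim.sat_iff {α : Type} {k : ℕ} {v u : Val α} (h : WSim k v u) (ψ : Constr α)
    (hb : ψ.BoundedBy k) : Constr.sat u ψ ↔ Constr.sat v ψ := by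
  induction ψ with
  | tt => exact Iff.rfl
  | lt x c =>
    have hc : (c : ℝ) ≤ k := by exact_mod_cast (show c ≤ k from hb)
    rcases h.clock x with e | ⟨r, s, hr, hs, h1, h2⟩
    · simp [Constr.sat, e]
    · simp only [Constr.sat, hr, hs, Option.some.injEq, exists_eq_left']
      constructor <;> intro <;> linarith
  | gt x c =>
    have hc : (c : ℝ) ≤ k := by exact_mod_cast (show c ≤ k from hb)
    rcases h.clock x with e | ⟨r, s, hr, hs, h1, h2⟩
    · simp [Constr.sat, e]
    · simp only [Constr.sat, hr, hs, Option.some.injEq, exists_eq_left']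
      constructor <;> intro <;> linarith
  | eq x c =>
    have hc : (c : ℝ) ≤ k := by exact_mod_cast (show c ≤ k from hb)
    rcases h.clock x with e | ⟨r, s, hr, hs, h1, h2⟩
    · simp [Constr.sat, e]
    · simp only [Constr.sat, hr, hs, Option.some.injEq]
      constructor <;> intro <;> linarith
  | not ψ ih => exact not_congr (ih hb)
  | and ψ₁ ψ₂ ih₁ ih₂ => exact and_congr (ih₁ hb.1) (ih₂ hb.2)

theorem Nonneg.set_zero {α : Type} [DecidableEq α] {v : Val α} (h : Nonneg v) (x : Clock α) :
    Nonneg (v.set x (some 0)) := by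
  intro y r hy
  unfold Val.set at hy
  split_ifs at hy with e
  · simp at hy; exact hy.le
  · exact h y r hy

theorem ECAcc.toWAcc {α Q : Type} [DecidableEq α] {A : ECTA α Q} (k : ℕ) {q : Q} {v : Val α}
    {θ : List (ℝ × α)} (h : ECAcc A q v θ) : WAcc A k q v θ := by
  induction h with
  | nil q v hq hv => exact WAcc.nil q v hq hv
  | cons q v t σ q' v' w hs _ ih =>
    obtain ⟨⟨ht, hc⟩, hd⟩ := hs
    refine WAcc.cons q v t (elapse v t) σ q' v' w ⟨ht, ?_, fun a => rfl, ?_, ?_⟩ hd ih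
    · obtain ⟨ψ, _, vb, hvb, e, _⟩ := hd
      rw [← e]; exact hvb.set_zero _
    · intro a ha; simp [elapse, ha]
    · intro a r ha
      refine ⟨fun hr => ⟨r - t, by simp [elapse, ha], by linarith⟩,
        fun _ => ⟨hc a r ha, by simp [elapse, ha]⟩⟩

theorem WAcc.toECAcc {α Q : Type} [DecidableEq α] {A : ECTA α Q} {k : ℕ}
    (hmax : MaxConstLe A k) {q : Q} {v : Val α}
    {θ : List (ℝ × α)} (h : WAcc A k q v θ) (hv : Nonneg v) :
    ∃ u, WSim k v u ∧ Nonneg u ∧ ECAcc A q u θ := by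
  induction h with
  | nil q v hq hf =>
    exact ⟨v, ⟨fun _ => rfl, fun _ => Or.inl rfl⟩, hv, ECAcc.nil q v hq hf⟩
  | cons q v t v'' σ q' v' w hs hd _ ih =>
    obtain ⟨ψ, he, vb, hvb, e1, e2, hsat⟩ := hd
    obtain ⟨u', hsim, hu', hacc⟩ := ih (by rw [← e2]; exact hvb.set_zero _)
    obtain ⟨ht, hn, hh, hp0, hp⟩ := hs
    let ub : Val α := u'.set (.hist σ) (vb (.hist σ))
    have hub : Nonneg ub := by
      intro y r hy
      simp only [ub, Val.set] at hy
      split_ifs at hy with e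
      · exact hvb _ r hy
      · exact hu' y r hy
    have hbsim : WSim k vb ub := by
      subst e2
      constructor
      · intro a
        have := hsim.1 a
        simp only [ub, Val.set] at this ⊢
        split_ifs at this ⊢ with e
        · rw [e]
        · exact this
      · intro a
        have := hsim.2 a
        simpa [ub, Val.set] using this
    let u'' : Val α := ub.set (.proph σ) (some 0)
    have hu'' : Nonneg u'' := hub.set_zero _
    have hsim'' : WSim k v'' u'' := by
      subst e1
      constructor
      · intro a
        simpa [u'', Val.set] using hbsim.1 a
      · intro a
        have := hbsim.2 a
        simp only [u'', Val.set]
        split_ifs with e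
        · exact Or.inl rfl
        · exact this
    let u : Val α := fun c => match c with
      | .hist a => v (.hist a)
      | .proph a => (u'' (.proph a)).map (· + t)
    have hel : elapse u t = u'' := by
      funext c
      cases c with
      | hist a => simp only [elapse, u]; rw [hsim''.1 a, hh a]
      | proph a =>
        simp only [elapse, u]
        cases u'' (.proph a) <;> simp
    refine ⟨u, ⟨fun a => rfl, ?_⟩, ?_, ECAcc.cons q u t σ q' u' w ⟨⟨ht, ?_⟩, ?_⟩ hacc⟩
    · intro a
      have h2 := hsim''.2 a
      cases hva : v (.proph a) with
      | none =>
        rw [hp0 a hva] at h2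
        left
        rcases h2 with h2 | ⟨r, s, h2, _⟩
        · simp [u, h2]
        · simp at h2
      | some r =>
        obtain ⟨hA, hB⟩ := hp a r hva
        rcases lt_or_ge (k : ℝ) r with hr | hr
        · right
          obtain ⟨r', hr', hlt⟩ := hA hr
          rcases h2 with h2 | ⟨r₁, s, _, h2, _, h3⟩
          · exact ⟨r, r' + t, rfl, by simp [u, h2, hr'], hr, by linarith⟩
          · exact ⟨r, s + t, rfl, by simp [u, h2], hr, by linarith⟩
        · left
          obtain ⟨htr, hv2⟩ := hB hr
          rcases h2 with h2 | ⟨r₁, s, h1, _, h3, _⟩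
          · simp [u, h2, hv2]
          · rw [hv2] at h1
            simp at h1
            linarith
    · intro c r hc
      cases c with
      | hist a => exact hv _ r hc
      | proph a =>
        simp only [u, Option.map_eq_some_iff] at hc
        obtain ⟨s, hs, rfl⟩ := hc
        have := hu'' _ s hs
        linarith
    · intro a r hc
      simp only [u, Option.map_eq_some_iff] at hc
      obtain ⟨s, hs, rfl⟩ := hc
      have := hu'' _ s hs
      linarith
    · rw [hel]
      refine ⟨ψ, he, ub, hub, rfl, ?_, (hbsim.sat_iff ψ (hmax _ he)).2 hsat⟩
      funext y
      simp only [ub, Val.set]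
      split_ifs with e
      · rw [e, hsim.1 σ, ← e2]
        simp [Val.set]
      · rfl

/-- For every ECTA `A` with maximal constant `cmax`, the weak language equals the
language: `L(A) = wL(A)`. -/
theorem lang_eq_weak_lang {α Q : Type} [DecidableEq α] (A : ECTA α Q) (cmax : ℕ)
    (hmax : MaxConstLe A cmax) :
    TLang A = WLang A cmax := by
  ext θ
  constructor
  · rintro ⟨v, hn, hi, h⟩
    exact ⟨v, hn, hi, h.toWAcc cmax⟩
  · rintro ⟨v, hn, hi, h⟩
    obtain ⟨u, hs, hu, hacc⟩ := h.toECAcc hmax hn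
    exact ⟨u, hu, fun a => (hs.1 a).trans (hi a), hacc⟩
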